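/- Let u be a solution of -Δu = f(u) in B₁ with ∇u(0,0) = (0,0), u_xx(0,0) = u_xy(0,0) = 0, u_yy(0,0) ≠ 0 (which holds in particular whenever the index of ∇u at (0,0) is greater than -2), and ∂u/∂x ≢ 0 on B₁. Let n ≥ 3 be the smallest integer such that ∂ⁿu/∂x^{n-k}∂y^k(0,0) ≠ 0 for some k ∈ {0,…,n-1}. Then: (i) (∂ⁿu/∂xⁿ(0,0), ∂ⁿu/∂x^{n-1}∂y(0,0)) ≠ (0,0); (ii) ∂ⁿu/∂x^{n-2k}∂y^{2k}(0,0) = (-1)^k ∂ⁿu/∂xⁿ(0,0) for 0 ≤ 2k ≤ n-1 and ∂ⁿu/∂x^{n-2k-1}∂y^{2k+1}(0,0) = (-1)^k ∂ⁿu/∂x^{n-1}∂y(0,0) for 0 ≤ 2k+1 ≤ n-1; (iii) there exist a constant C > 0 and a function ε₁ with ε₁(x,y) → 0 as (x,y) → (0,0) such that u(x,y) = u(0,0) + (u_yy(0,0)/2 + ε₁(x,y)) y² + (∂ⁿu/∂xⁿ(0,0)/n!) Re(zⁿ) + (∂ⁿu/∂x^{n-1}∂y(0,0)/n!) Im(zⁿ)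 + R(x,y) with |R(x,y)| ≤ C(x²+y²)^{(n+1)/2} near the origin, where z = x + iy. -/

import Mathlib

open Filter Metric Set

/-- Partial derivative in the first variable. -/
noncomputable def pdx (u : ℝ → ℝ → ℝ) : ℝ → ℝ → ℝ := fun x y => deriv (fun t => u t y) x

/-- Partial derivative in the second variable. -/
noncomputable def pdy (u : ℝ → ℝ → ℝ) : ℝ → ℝ → ℝ := fun x y => deriv (fun t => u x t) y

/-- `pd u i j = ∂^(i+j) u / ∂x^i ∂y^j`. -/
noncomputable def pd (u : ℝ → ℝ → ℝ) (i j : ℕ) : ℝ → ℝ → ℝ := pdx^[i] (pdy^[j] u)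

/-- The open unit ball of `ℝ²`. -/
def B1 : Set (ℝ × ℝ) := Metric.ball (0 : ℝ × ℝ) 1

/-- Real part of `(x+iy)^n`. -/
noncomputable def ReZ (n : ℕ) (x y : ℝ) : ℝ := (((x : ℂ) + (y : ℂ) * Complex.I) ^ n).re

/-- Imaginary part of `(x+iy)^n`. -/
noncomputable def ImZ (n : ℕ) (x y : ℝ) : ℝ := (((x : ℂ) + (y : ℂ) * Complex.I) ^ n).im

/-- Smoothness on the ball. -/
def Sm (w : ℝ → ℝ → ℝ) : Prop :=
  ContDiffOn ℝ (⊤ : ℕ∞) (fun p : ℝ × ℝ => w p.1 p.2) B1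

/-- Equality on the ball. -/
def EqB (v w : ℝ → ℝ → ℝ) : Prop := ∀ x y : ℝ, (x, y) ∈ B1 → v x y = w x y

/-- All derivatives of order `< m` (in any order) vanish at the origin. -/
def Van : ℕ → (ℝ → ℝ → ℝ) → Prop
  | 0, _ => True
  | m + 1, w => w 0 0 = 0 ∧ Van m (pdx w) ∧ Van m (pdy w)

lemma isOpen_B1 : IsOpen B1 := Metric.isOpen_ball

lemma zero_mem_B1 : ((0 : ℝ), (0 : ℝ)) ∈ B1 := by
  have : (0 : ℝ × ℝ) ∈ B1 := Metric.mem_ball_self one_pos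
  exact this

lemma EqB.pdx {v w : ℝ → ℝ → ℝ} (h : EqB v w) : EqB (pdx v) (pdx w) := by
  intro x y hxy
  apply Filter.EventuallyEq.deriv_eq
  have hc : ContinuousAt (fun t : ℝ => (t, y)) x := by fun_prop
  filter_upwards [hc.preimage_mem_nhds (isOpen_B1.mem_nhds hxy)] with t ht
  exact h t y ht

lemma EqB.pdy {v w : ℝ → ℝ → ℝ} (h : EqB v w) : EqB (pdy v) (pdy w) := by
  intro x y hxy
  apply Filter.EventuallyEq.deriv_eq
  have hc : ContinuousAt (fun t : ℝ => (x, t)) y := by fun_prop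
  filter_upwards [hc.preimage_mem_nhds (isOpen_B1.mem_nhds hxy)] with t ht
  exact h x t ht

lemma EqB.trans {u v w : ℝ → ℝ → ℝ} (h : EqB u v) (h' : EqB v w) : EqB u w :=
  fun x y hxy => (h x y hxy).trans (h' x y hxy)

lemma EqB.symm {u v : ℝ → ℝ → ℝ} (h : EqB u v) : EqB v u :=
  fun x y hxy => (h x y hxy).symm

lemma EqB.refl (u : ℝ → ℝ → ℝ) : EqB u u := fun _ _ _ => rfl

lemma EqB.pdx_iter {v w : ℝ → ℝ → ℝ} (h : EqB v w) (i : ℕ) :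
    EqB (_root_.pdx^[i] v) (_root_.pdx^[i] w) := by
  induction i generalizing v w with
  | zero => exact h
  | succ i ih => exact ih h.pdx

lemma EqB.pdy_iter {v w : ℝ → ℝ → ℝ} (h : EqB v w) (i : ℕ) :
    EqB (_root_.pdy^[i] v) (_root_.pdy^[i] w) := by
  induction i generalizing v w with
  | zero => exact h
  | succ i ih => exact ih h.pdy

lemma EqB.pd {v w : ℝ → ℝ → ℝ} (h : EqB v w) (i j : ℕ) : EqB (pd v i j) (pd w i j) :=
  (h.pdy_iter j).pdx_iter i

lemma EqB.van {m : ℕ} {v w : ℝ → ℝ → ℝ} (h : EqB v w) (hv : Van m v) : Van m w := by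
  induction m generalizing v w with
  | zero => trivial
  | succ m ih =>
    exact ⟨(h 0 0 zero_mem_B1) ▸ hv.1, ih h.pdx hv.2.1, ih h.pdy hv.2.2⟩

lemma Sm.congr {v w : ℝ → ℝ → ℝ} (hv : Sm v) (h : EqB v w) : Sm w :=
  ContDiffOn.congr hv (fun p hp => (h p.1 p.2 hp).symm)

lemma Sm.contDiffAt {w : ℝ → ℝ → ℝ} (h : Sm w) {p : ℝ × ℝ} (hp : p ∈ B1) :
    ContDiffAt ℝ (⊤ : ℕ∞) (fun p : ℝ × ℝ => w p.1 p.2) p :=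
  ContDiffOn.contDiffAt h (isOpen_B1.mem_nhds hp)

lemma Sm.differentiableAt {w : ℝ → ℝ → ℝ} (h : Sm w) {p : ℝ × ℝ} (hp : p ∈ B1) :
    DifferentiableAt ℝ (fun p : ℝ × ℝ => w p.1 p.2) p :=
  (h.contDiffAt hp).differentiableAt (by simp)

lemma Sm.hasX {w : ℝ → ℝ → ℝ} (h : Sm w) {x y : ℝ} (hp : (x, y) ∈ B1) :
    HasDerivAt (fun t => w t y) (fderiv ℝ (fun p : ℝ × ℝ => w p.1 p.2) (x, y) (1, 0)) x := by
  have h1 := (h.differentiableAt hp).hasFDerivAt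
  have h2 : HasDerivAt (fun t : ℝ => (t, y)) ((1 : ℝ), (0 : ℝ)) x :=
    (hasDerivAt_id x).prodMk (hasDerivAt_const x y)
  exact HasFDerivAt.comp_hasDerivAt x h1 h2

lemma Sm.hasY {w : ℝ → ℝ → ℝ} (h : Sm w) {x y : ℝ} (hp : (x, y) ∈ B1) :
    HasDerivAt (fun t => w x t) (fderiv ℝ (fun p : ℝ × ℝ => w p.1 p.2) (x, y) (0, 1)) y := by
  have h1 := (h.differentiableAt hp).hasFDerivAt
  have h2 : HasDerivAt (fun t : ℝ => (x, t)) ((0 : ℝ), (1 : ℝ)) y :=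
    (hasDerivAt_const y x).prodMk (hasDerivAt_id y)
  exact HasFDerivAt.comp_hasDerivAt y h1 h2

lemma Sm.pdx_eq {w : ℝ → ℝ → ℝ} (h : Sm w) : EqB
    (fun x y => fderiv ℝ (fun p : ℝ × ℝ => w p.1 p.2) (x, y) (1, 0)) (pdx w) :=
  fun _ _ hp => (h.hasX hp).deriv.symm

lemma Sm.pdy_eq {w : ℝ → ℝ → ℝ} (h : Sm w) : EqB
    (fun x y => fderiv ℝ (fun p : ℝ × ℝ => w p.1 p.2) (x, y) (0, 1)) (pdy w) :=
  fun _ _ hp => (h.hasY hp).deriv.symm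

lemma Sm.fd {w : ℝ → ℝ → ℝ} (h : Sm w) :
    ContDiffOn ℝ (⊤ : ℕ∞) (fderiv ℝ (fun p : ℝ × ℝ => w p.1 p.2)) B1 :=
  ContDiffOn.fderiv_of_isOpen h isOpen_B1 (by simp)

lemma Sm.fdv {w : ℝ → ℝ → ℝ} (h : Sm w) (a : ℝ × ℝ) :
    Sm (fun x y => fderiv ℝ (fun p : ℝ × ℝ => w p.1 p.2) (x, y) a) :=
  h.fd.clm_apply contDiffOn_const

lemma Sm.pdx {w : ℝ → ℝ → ℝ} (h : Sm w) : Sm (pdx w) := (h.fdv _).congr h.pdx_eq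

lemma Sm.pdy {w : ℝ → ℝ → ℝ} (h : Sm w) : Sm (pdy w) := (h.fdv _).congr h.pdy_eq

lemma Sm.pdy_iter {w : ℝ → ℝ → ℝ} (h : Sm w) (j : ℕ) : Sm (_root_.pdy^[j] w) := by
  induction j generalizing w with
  | zero => exact h
  | succ i ih => exact ih h.pdy

lemma Sm.pdx_iter {w : ℝ → ℝ → ℝ} (h : Sm w) (j : ℕ) : Sm (_root_.pdx^[j] w) := by
  induction j generalizing w with
  | zero => exact h
  | succ i ih => exact ih h.pdx

lemma Sm.comm {w : ℝ → ℝ → ℝ} (h : Sm w) : EqB (_root_.pdx (_root_.pdy w)) (_root_.pdy (_root_.pdx w)) := by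
  have hx := (h.pdx_eq.symm.pdy).trans (h.fdv _).pdy_eq.symm
  have hy := (h.pdy_eq.symm.pdx).trans (h.fdv _).pdx_eq.symm
  refine hy.trans (EqB.trans ?_ hx.symm)
  intro x y hp
  have hd : DifferentiableAt ℝ (fderiv ℝ (fun p : ℝ × ℝ => w p.1 p.2)) (x, y) :=
    (h.fd.contDiffAt (isOpen_B1.mem_nhds hp)).differentiableAt (by simp)
  have hs : IsSymmSndFDerivAt ℝ (fun p : ℝ × ℝ => w p.1 p.2) (x, y) :=
    (h.contDiffAt hp).isSymmSndFDerivAt (by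
      rw [minSmoothness_of_isRCLikeNormedField]
      exact WithTop.coe_le_coe.2 (le_top : (2 : ℕ∞) ≤ ⊤))
  have key : ∀ a b : ℝ × ℝ, fderiv ℝ (fun p : ℝ × ℝ =>
      fderiv ℝ (fun p : ℝ × ℝ => w p.1 p.2) (p.1, p.2) a) (x, y) b
      = fderiv ℝ (fderiv ℝ (fun p : ℝ × ℝ => w p.1 p.2)) (x, y) b a := by
    intro a b
    have := (hd.hasFDerivAt.clm_apply (hasFDerivAt_const a (x, y))).fderiv
    simp only [Prod.mk.eta]
    rw [this]
    simp
  simp only [key]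
  exact hs.eq _ _

lemma Sm.pdy_iter_pdx {w : ℝ → ℝ → ℝ} (h : Sm w) (j : ℕ) :
    EqB (_root_.pdy^[j] (_root_.pdx w)) (_root_.pdx (_root_.pdy^[j] w)) := by
  induction j generalizing w with
  | zero => exact EqB.refl _
  | succ j ih => exact (h.comm.symm.pdy_iter j).trans (ih h.pdy)

lemma Sm.pd_pdx {w : ℝ → ℝ → ℝ} (h : Sm w) (i j : ℕ) :
    EqB (pd (_root_.pdx w) i j) (pd w (i + 1) j) :=
  (h.pdy_iter_pdx j).pdx_iter i

lemma pd_pdy (w : ℝ → ℝ → ℝ) (i j : ℕ) : pd (pdy w) i j = pd w i (j + 1) := rfl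

lemma Van.of_pd {m : ℕ} {w : ℝ → ℝ → ℝ} (h : Sm w)
    (hv : ∀ i j, i + j < m → pd w i j 0 0 = 0) : Van m w := by
  induction m generalizing w with
  | zero => trivial
  | succ m ih =>
    refine ⟨hv 0 0 (by omega), ih h.pdx ?_, ih h.pdy ?_⟩
    · intro i j hij
      rw [h.pd_pdx i j 0 0 zero_mem_B1]
      exact hv _ _ (by omega)
    · intro i j hij
      exact hv i (j + 1) (by omega)

lemma Van.pd {m : ℕ} {w : ℝ → ℝ → ℝ} (hv : Van m w) {i j : ℕ} (hij : i + j < m) :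
    pd w i j 0 0 = 0 := by
  have hy : ∀ (j : ℕ) (m : ℕ) (w : ℝ → ℝ → ℝ), Van (m + j) w → Van m (_root_.pdy^[j] w) := by
    intro j
    induction j with
    | zero => intro m w h; exact h
    | succ j ih => intro m w h; exact ih m _ h.2.2
  have hx : ∀ (j : ℕ) (m : ℕ) (w : ℝ → ℝ → ℝ), Van (m + j) w → Van m (_root_.pdx^[j] w) := by
    intro j
    induction j with
    | zero => intro m w h; exact h
    | succ j ih => intro m w h; exact ih m _ h.2.1
  obtain ⟨r, rfl⟩ : ∃ r, m = ((r + 1) + i) + j := ⟨m - i - j - 1, by omega⟩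
  exact (hx _ _ _ (hy _ _ _ hv)).1

lemma Van.mono {m : ℕ} {w : ℝ → ℝ → ℝ} (hv : Van (m + 1) w) : Van m w := by
  induction m generalizing w with
  | zero => trivial
  | succ m ih => exact ⟨hv.1, ih hv.2.1, ih hv.2.2⟩

lemma Sm.add {v w : ℝ → ℝ → ℝ} (hv : Sm v) (hw : Sm w) : Sm (fun x y => v x y + w x y) :=
  ContDiffOn.add hv hw

lemma Sm.mul {v w : ℝ → ℝ → ℝ} (hv : Sm v) (hw : Sm w) : Sm (fun x y => v x y * w x y) :=
  ContDiffOn.mul hv hw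

lemma Sm.dx {w : ℝ → ℝ → ℝ} (h : Sm w) {x y : ℝ} (hp : (x, y) ∈ B1) :
    HasDerivAt (fun t => w t y) (_root_.pdx w x y) x := by
  rw [← h.pdx_eq x y hp]; exact h.hasX hp

lemma Sm.dy {w : ℝ → ℝ → ℝ} (h : Sm w) {x y : ℝ} (hp : (x, y) ∈ B1) :
    HasDerivAt (fun t => w x t) (_root_.pdy w x y) y := by
  rw [← h.pdy_eq x y hp]; exact h.hasY hp

lemma Sm.pdx_add {v w : ℝ → ℝ → ℝ} (hv : Sm v) (hw : Sm w) :
    EqB (_root_.pdx (fun x y => v x y + w x y))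
      (fun x y => _root_.pdx v x y + _root_.pdx w x y) :=
  fun _ _ hp => ((hv.dx hp).add (hw.dx hp)).deriv

lemma Sm.pdy_add {v w : ℝ → ℝ → ℝ} (hv : Sm v) (hw : Sm w) :
    EqB (_root_.pdy (fun x y => v x y + w x y))
      (fun x y => _root_.pdy v x y + _root_.pdy w x y) :=
  fun _ _ hp => ((hv.dy hp).add (hw.dy hp)).deriv

lemma Sm.pdx_mul {v w : ℝ → ℝ → ℝ} (hv : Sm v) (hw : Sm w) :
    EqB (_root_.pdx (fun x y => v x y * w x y))
      (fun x y => _root_.pdx v x y * w x y + v x y * _root_.pdx w x y) :=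
  fun _ _ hp => ((hv.dx hp).mul (hw.dx hp)).deriv

lemma Sm.pdy_mul {v w : ℝ → ℝ → ℝ} (hv : Sm v) (hw : Sm w) :
    EqB (_root_.pdy (fun x y => v x y * w x y))
      (fun x y => _root_.pdy v x y * w x y + v x y * _root_.pdy w x y) :=
  fun _ _ hp => ((hv.dy hp).mul (hw.dy hp)).deriv

lemma Sm.pd_add {v w : ℝ → ℝ → ℝ} (hv : Sm v) (hw : Sm w) (i j : ℕ) :
    EqB (pd (fun x y => v x y + w x y) i j) (fun x y => pd v i j x y + pd w i j x y) := by
  have hy : ∀ (j : ℕ) (v w : ℝ → ℝ → ℝ), Sm v → Sm w →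
      EqB (_root_.pdy^[j] (fun x y => v x y + w x y))
        (fun x y => _root_.pdy^[j] v x y + _root_.pdy^[j] w x y) := by
    intro j
    induction j with
    | zero => intro v w _ _; exact EqB.refl _
    | succ j ih =>
      intro v w hv hw
      exact ((hv.pdy_add hw).pdy_iter j).trans (ih _ _ hv.pdy hw.pdy)
  have hx : ∀ (j : ℕ) (v w : ℝ → ℝ → ℝ), Sm v → Sm w →
      EqB (_root_.pdx^[j] (fun x y => v x y + w x y))
        (fun x y => _root_.pdx^[j] v x y + _root_.pdx^[j] w x y) := by
    intro j
    induction j with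
    | zero => intro v w _ _; exact EqB.refl _
    | succ j ih =>
      intro v w hv hw
      exact ((hv.pdx_add hw).pdx_iter j).trans (ih _ _ hv.pdx hw.pdx)
  exact ((hy j v w hv hw).pdx_iter i).trans (hx i _ _ (hv.pdy_iter j) (hw.pdy_iter j))

lemma Van.add {m : ℕ} {v w : ℝ → ℝ → ℝ} (sv : Sm v) (sw : Sm w) (hv : Van m v) (hw : Van m w) :
    Van m (fun x y => v x y + w x y) := by
  induction m generalizing v w with
  | zero => trivial
  | succ m ih =>
    refine ⟨by simp [hv.1, hw.1], ?_, ?_⟩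
    · exact (sv.pdx_add sw).symm.van (ih sv.pdx sw.pdx hv.2.1 hw.2.1)
    · exact (sv.pdy_add sw).symm.van (ih sv.pdy sw.pdy hv.2.2 hw.2.2)

lemma Van.mul {m : ℕ} {v w : ℝ → ℝ → ℝ} (sv : Sm v) (sw : Sm w) (hw : Van m w) :
    Van m (fun x y => v x y * w x y) := by
  induction m generalizing v w with
  | zero => trivial
  | succ m ih =>
    refine ⟨by simp [hw.1], ?_, ?_⟩
    · exact (sv.pdx_mul sw).symm.van (Van.add (sv.pdx.mul sw) (sv.mul sw.pdx)
        (ih sv.pdx sw hw.mono) (ih sv sw.pdx hw.2.1))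
    · exact (sv.pdy_mul sw).symm.van (Van.add (sv.pdy.mul sw) (sv.mul sw.pdy)
        (ih sv.pdy sw hw.mono) (ih sv sw.pdy hw.2.2))

lemma Van.bound {m : ℕ} {w : ℝ → ℝ → ℝ} (sw : Sm w) (hw : Van m w) :
    ∃ C : ℝ, 0 < C ∧ ∃ δ : ℝ, 0 < δ ∧ ∀ p : ℝ × ℝ, ‖p‖ < δ → |w p.1 p.2| ≤ C * ‖p‖ ^ m := by
  induction m generalizing w with
  | zero =>
    have hc : ContinuousAt (fun p : ℝ × ℝ => w p.1 p.2) 0 :=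
      (sw.differentiableAt zero_mem_B1).continuousAt
    obtain ⟨δ, hδ, h⟩ := Metric.continuousAt_iff.1 hc 1 one_pos
    refine ⟨|w 0 0| + 1, by positivity, δ, hδ, fun p hp => ?_⟩
    have := h (x := p) (by simpa using hp)
    rw [Real.dist_eq] at this
    simp only [Prod.fst_zero, Prod.snd_zero] at this
    have h2 := abs_add_le (w p.1 p.2 - w 0 0) (w 0 0)
    simp only [sub_add_cancel] at h2
    simp; linarith
  | succ m ih =>
    obtain ⟨C₁, hC₁, δ₁, hδ₁, h₁⟩ := ih sw.pdx hw.2.1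
    obtain ⟨C₂, hC₂, δ₂, hδ₂, h₂⟩ := ih sw.pdy hw.2.2
    refine ⟨C₁ + C₂, by positivity, min 1 (min δ₁ δ₂), by positivity, fun p hp => ?_⟩
    have hp1 : ‖p‖ < 1 := lt_of_lt_of_le hp (min_le_left _ _)
    have hp2 : ‖p‖ < δ₁ := lt_of_lt_of_le hp ((min_le_right _ _).trans (min_le_left _ _))
    have hp3 : ‖p‖ < δ₂ := lt_of_lt_of_le hp ((min_le_right _ _).trans (min_le_right _ _))
    have key := (convex_closedBall (0 : ℝ × ℝ) ‖p‖).norm_image_sub_le_of_norm_fderiv_le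
      (𝕜 := ℝ) (f := fun p : ℝ × ℝ => w p.1 p.2) (C := (C₁ + C₂) * ‖p‖ ^ m) (x := 0) (y := p)
      ?_ ?_ (by simp) (by simp)
    · simp only [sub_zero, Real.norm_eq_abs, Prod.fst_zero, Prod.snd_zero, hw.1] at key
      rw [pow_succ, ← mul_assoc]; exact key
    · intro q hq
      apply sw.differentiableAt
      have : ‖q‖ ≤ ‖p‖ := by simpa using hq
      simp [B1]; linarith
    · intro q hq
      have hqp : ‖q‖ ≤ ‖p‖ := by simpa using hq
      have hqB : (q.1, q.2) ∈ B1 := by simp [B1]; linarith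
      have e1 := sw.pdx_eq _ _ hqB
      have e2 := sw.pdy_eq _ _ hqB
      have b1 := h₁ q (by linarith)
      have b2 := h₂ q (by linarith)
      have hpow : ‖q‖ ^ m ≤ ‖p‖ ^ m := by gcongr
      rw [← e1] at b1
      rw [← e2] at b2
      simp only [Prod.mk.eta] at b1 b2
      refine ContinuousLinearMap.opNorm_le_bound _ (by positivity) fun a => ?_
      have ha : a = a.1 • ((1 : ℝ), (0 : ℝ)) + a.2 • ((0 : ℝ), (1 : ℝ)) := by
        ext <;> simp
      have ha1 : |a.1| ≤ ‖a‖ := norm_fst_le a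
      have ha2 : |a.2| ≤ ‖a‖ := norm_snd_le a
      conv_lhs => rw [ha]
      rw [map_add, map_smul, map_smul, Real.norm_eq_abs]
      refine (abs_add_le _ _).trans ?_
      rw [smul_eq_mul, smul_eq_mul, abs_mul, abs_mul]
      calc _ ≤ ‖a‖ * (C₁ * ‖p‖ ^ m) + ‖a‖ * (C₂ * ‖p‖ ^ m) := by
            gcongr
            · exact b1.trans (by gcongr)
            · exact b2.trans (by gcongr)
        _ = _ := by ring

/-- The real part of `c z ^ n`. -/
noncomputable def Har (c : ℂ) (n : ℕ) : ℝ → ℝ → ℝ :=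
  fun x y => (c * ((x : ℂ) + (y : ℂ) * Complex.I) ^ n).re

lemma Har_pdx (c : ℂ) (n : ℕ) : pdx (Har c n) = Har (n * c) (n - 1) := by
  funext x y
  have h1 : HasDerivAt (fun t : ℝ => ((t : ℂ) + (y : ℂ) * Complex.I)) 1 x :=
    (Complex.ofRealCLM.hasDerivAt (x := x)).add_const _
  have h2 := Complex.reCLM.hasFDerivAt.comp_hasDerivAt x ((h1.pow n).const_mul c)
  refine h2.deriv.trans ?_
  simp only [Har, Complex.reCLM_apply]
  congr 1; ring

lemma Har_pdy (c : ℂ) (n : ℕ) : pdy (Har c n) = Har (n * Complex.I * c) (n - 1) := by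
  funext x y
  have h1 : HasDerivAt (fun t : ℝ => ((x : ℂ) + (t : ℂ) * Complex.I)) (1 * Complex.I) y :=
    ((Complex.ofRealCLM.hasDerivAt (x := y)).mul_const Complex.I).const_add _
  have h2 := Complex.reCLM.hasFDerivAt.comp_hasDerivAt y ((h1.pow n).const_mul c)
  refine h2.deriv.trans ?_
  simp only [Har, Complex.reCLM_apply]
  congr 1; ring

lemma Har_sm (c : ℂ) (n : ℕ) : Sm (Har c n) := by
  apply ContDiff.contDiffOn
  have h : ContDiff ℝ (⊤ : ℕ∞) (fun p : ℝ × ℝ => c * ((p.1 : ℂ) + (p.2 : ℂ) * Complex.I) ^ n) := by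
    have a1 : ContDiff ℝ (⊤ : ℕ∞) (fun p : ℝ × ℝ => (p.1 : ℂ)) :=
      Complex.ofRealCLM.contDiff.comp contDiff_fst
    have a2 : ContDiff ℝ (⊤ : ℕ∞) (fun p : ℝ × ℝ => (p.2 : ℂ)) :=
      Complex.ofRealCLM.contDiff.comp contDiff_snd
    exact contDiff_const.mul ((a1.add (a2.mul contDiff_const)).pow n)
  exact Complex.reCLM.contDiff.comp h

lemma Har_pd (c : ℂ) (n i j : ℕ) :
    pd (Har c n) i j = Har (n.descFactorial (j + i) * Complex.I ^ j * c) (n - (j + i)) := by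
  have hy : ∀ (j : ℕ), pdy^[j] (Har c n) = Har (n.descFactorial j * Complex.I ^ j * c) (n - j) := by
    intro j
    induction j with
    | zero => simp
    | succ j ih =>
      rw [Function.iterate_succ_apply', ih, Har_pdy, Nat.descFactorial_succ]
      congr 1
      push_cast; ring
  have hx : ∀ (i : ℕ), pdx^[i] (pdy^[j] (Har c n)) =
      Har (n.descFactorial (j + i) * Complex.I ^ j * c) (n - (j + i)) := by
    intro i
    induction i with
    | zero => simp [hy]
    | succ i ih =>
      rw [Function.iterate_succ_apply', ih, Har_pdx, ← add_assoc, Nat.descFactorial_succ]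
      congr 1
      push_cast; ring
  exact hx i

lemma Har_pd_lt (c : ℂ) {n i j : ℕ} (h : i + j < n) : pd (Har c n) i j 0 0 = 0 := by
  rw [Har_pd]
  have : n - (j + i) ≠ 0 := by omega
  simp [Har, this]

lemma Har_pd_eq (c : ℂ) {n i j : ℕ} (h : i + j = n) :
    pd (Har c n) i j 0 0 = n.factorial * (Complex.I ^ j * c).re := by
  rw [Har_pd]
  have h1 : j + i = n := by omega
  rw [h1, Nat.descFactorial_self]
  simp only [Har, Nat.sub_self, pow_zero, mul_one, mul_assoc]
  exact Complex.re_ofReal_mul (n.factorial : ℝ) _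

/-- A polynomial in the second variable. -/
noncomputable def Pol (P : Polynomial ℝ) : ℝ → ℝ → ℝ := fun _ y => P.eval y

lemma Pol_sm (P : Polynomial ℝ) : Sm (Pol P) := by
  apply ContDiff.contDiffOn
  have h : ContDiff ℝ (⊤ : ℕ∞) (fun y : ℝ => P.eval y) := by
    simpa using P.contDiff_aeval (𝕜 := ℝ) (⊤ : ℕ∞)
  exact h.comp contDiff_snd

lemma Pol_pdy (P : Polynomial ℝ) (j : ℕ) :
    pdy^[j] (Pol P) = Pol (Polynomial.derivative^[j] P) := by
  induction j generalizing P with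
  | zero => rfl
  | succ j ih =>
    have : pdy (Pol P) = Pol (Polynomial.derivative P) := by
      funext x y
      exact P.deriv
    rw [Function.iterate_succ_apply, this, ih, Function.iterate_succ_apply]

lemma Pol_pd_zero (P : Polynomial ℝ) (j : ℕ) :
    pd (Pol P) 0 j 0 0 = j.factorial * P.coeff j := by
  simp only [pd, Function.iterate_zero, id, Pol_pdy, Pol]
  rw [← Polynomial.coeff_zero_eq_eval_zero, Polynomial.coeff_iterate_derivative]
  simp [Nat.descFactorial_self]

lemma Pol_pd_succ (P : Polynomial ℝ) (i j : ℕ) (x y : ℝ) :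
    pd (Pol P) (i + 1) j x y = 0 := by
  have h0 : ∀ i, pdx^[i] (fun _ _ => (0 : ℝ)) = fun _ _ => (0 : ℝ) := by
    intro i
    induction i with
    | zero => rfl
    | succ i ih =>
      rw [Function.iterate_succ_apply']
      rw [ih]; funext x y; simp [pdx]
  have h1 : pdx (Pol (Polynomial.derivative^[j] P)) = fun _ _ => (0 : ℝ) := by
    funext x y; simp [pdx, Pol]
  simp only [pd, Pol_pdy, Function.iterate_succ_apply, h1, h0]


/-- expansion for a degenerate critical point with `u_yy(0,0) ≠ 0`
(which holds in particular whenever the index of `∇u` at the origin is `> -2`). -/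
theorem expansion_uyy_nonzero
    (u : ℝ → ℝ → ℝ) (f : ℝ → ℝ)
    (hu : ContDiffOn ℝ (⊤ : ℕ∞) (fun p : ℝ × ℝ => u p.1 p.2) B1)
    (hf : ContDiff ℝ (⊤ : ℕ∞) f)
    (hpde : ∀ x y : ℝ, (x, y) ∈ B1 → -(pd u 2 0 x y + pd u 0 2 x y) = f (u x y))
    (hcx : pd u 1 0 0 0 = 0) (hcy : pd u 0 1 0 0 = 0)
    (hxx : pd u 2 0 0 0 = 0) (hxy : pd u 1 1 0 0 = 0)
    (hyy : pd u 0 2 0 0 ≠ 0)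
    (hux : ¬ ∀ x y : ℝ, (x, y) ∈ B1 → pd u 1 0 x y = 0)
    (n : ℕ) (hn3 : 3 ≤ n)
    (hnex : ∃ k, k < n ∧ pd u (n - k) k 0 0 ≠ 0)
    (hnmin : ∀ m, 3 ≤ m → m < n → ∀ k, k < m → pd u (m - k) k 0 0 = 0) :
    (¬ (pd u n 0 0 0 = 0 ∧ pd u (n - 1) 1 0 0 = 0)) ∧
    (∀ k : ℕ, 2 * k ≤ n - 1 →
      pd u (n - 2 * k) (2 * k) 0 0 = (-1 : ℝ) ^ k * pd u n 0 0 0) ∧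
    (∀ k : ℕ, 2 * k + 1 ≤ n - 1 →
      pd u (n - (2 * k + 1)) (2 * k + 1) 0 0 = (-1 : ℝ) ^ k * pd u (n - 1) 1 0 0) ∧
    ∃ C : ℝ, 0 < C ∧ ∃ ε₁ : ℝ × ℝ → ℝ,
      Filter.Tendsto ε₁ (nhds (0 : ℝ × ℝ)) (nhds 0) ∧
      ∃ δ : ℝ, 0 < δ ∧ ∀ x y : ℝ, x ^ 2 + y ^ 2 < δ ^ 2 →
        |u x y - (u 0 0 + (pd u 0 2 0 0 / 2 + ε₁ (x, y)) * y ^ 2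
            + pd u n 0 0 0 / (n.factorial : ℝ) * ReZ n x y
            + pd u (n - 1) 1 0 0 / (n.factorial : ℝ) * ImZ n x y)|
          ≤ C * (x ^ 2 + y ^ 2) ^ (((n : ℝ) + 1) / 2) := by
  have su : Sm u := hu
  have low : ∀ i j, i + j + 1 < n → pd u (i + 1) j 0 0 = 0 := by
    intro i j hij
    rcases Nat.lt_or_ge (i + j + 1) 3 with h | h
    · have : (i = 0 ∧ j = 0) ∨ (i = 1 ∧ j = 0) ∨ (i = 0 ∧ j = 1) := by omega
      rcases this with ⟨rfl, rfl⟩ | ⟨rfl, rfl⟩ | ⟨rfl, rfl⟩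
      · exact hcx
      · exact hxx
      · exact hxy
    · have := hnmin (i + j + 1) h hij j (by omega)
      rwa [show i + j + 1 - j = i + 1 by omega] at this
  -- the differentiated equation
  have rec1 : ∀ i j, i + j + 3 = n → pd u (i + 3) j 0 0 + pd u (i + 1) (j + 2) 0 0 = 0 := by
    intro i j hij
    have sf : Sm (fun x y => - deriv f (u x y)) := by
      have hdf : ContDiff ℝ (⊤ : ℕ∞) (deriv f) :=
        (contDiff_infty_iff_deriv.1 hf).2
      exact (hdf.comp_contDiffOn hu).neg
    have v1 : Van (n - 1) (pdx u) := by
      apply Van.of_pd su.pdx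
      intro a b hab
      rw [su.pd_pdx a b 0 0 zero_mem_B1]
      exact low a b (by omega)
    have v2 := Van.mul sf su.pdx v1
    have sxx : Sm (pdx (pdx u)) := su.pdx.pdx
    have syy : Sm (pdy (pdy u)) := su.pdy.pdy
    have e0 : EqB (fun x y => pdx (pdx u) x y + pdy (pdy u) x y) (fun x y => - f (u x y)) := by
      intro x y hp
      have := hpde x y hp
      have h2 : pdx (pdx u) x y + pdy (pdy u) x y = pd u 2 0 x y + pd u 0 2 x y := rfl
      simp only [h2]; linarith
    have e1 : EqB (pdx (fun x y => - f (u x y)))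
        (fun x y => - deriv f (u x y) * pdx u x y) := by
      intro x y hp
      have hd : HasDerivAt f (deriv f (u x y)) (u x y) :=
        ((hf.differentiable (by simp)) _).hasDerivAt
      have h3 := (HasDerivAt.comp x hd (su.dx hp)).neg.deriv
      have h4 : pdx (fun x y => - f (u x y)) x y
        = -(deriv f (u x y) * pdx u x y) := h3
      rw [h4]; ring
    have e2 := (e0.pdx.trans e1).symm.van v2
    have e3 := (sxx.pdx_add syy).van e2
    have e4 := e3.pd (i := i) (j := j) (by omega)
    rw [sxx.pdx.pd_add syy.pdx i j 0 0 zero_mem_B1] at e4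
    beta_reduce at e4
    rw [sxx.pd_pdx i j 0 0 zero_mem_B1,
      su.pdx.pd_pdx (i + 1) j 0 0 zero_mem_B1, su.pd_pdx (i + 2) j 0 0 zero_mem_B1,
      syy.pd_pdx i j 0 0 zero_mem_B1] at e4
    exact e4
  have ev : ∀ k : ℕ, 2 * k ≤ n - 1 →
      pd u (n - 2 * k) (2 * k) 0 0 = (-1 : ℝ) ^ k * pd u n 0 0 0 := by
    intro k
    induction k with
    | zero => intro _; simp
    | succ k ih =>
      intro hk
      have h1 := ih (by omega)
      have h2 := rec1 (n - 3 - 2 * k) (2 * k) (by omega)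
      rw [show n - 3 - 2 * k + 3 = n - 2 * k by omega,
        show n - 3 - 2 * k + 1 = n - 2 * (k + 1) by omega,
        show 2 * k + 2 = 2 * (k + 1) by ring] at h2
      rw [pow_succ]; linarith
  have od : ∀ k : ℕ, 2 * k + 1 ≤ n - 1 →
      pd u (n - (2 * k + 1)) (2 * k + 1) 0 0 = (-1 : ℝ) ^ k * pd u (n - 1) 1 0 0 := by
    intro k
    induction k with
    | zero => intro _; simp
    | succ k ih =>
      intro hk
      have h1 := ih (by omega)
      have h2 := rec1 (n - 3 - (2 * k + 1)) (2 * k + 1) (by omega)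
      rw [show n - 3 - (2 * k + 1) + 3 = n - (2 * k + 1) by omega,
        show n - 3 - (2 * k + 1) + 1 = n - (2 * (k + 1) + 1) by omega,
        show 2 * k + 1 + 2 = 2 * (k + 1) + 1 by ring] at h2
      rw [pow_succ]; linarith
  refine ⟨?_, ev, od, ?_⟩
  · rintro ⟨h1, h2⟩
    obtain ⟨k, hk, hne⟩ := hnex
    apply hne
    rcases Nat.even_or_odd' k with ⟨r, rfl | rfl⟩
    · rw [ev r (by omega), h1, mul_zero]
    · rw [od r (by omega), h2, mul_zero]
  set a : ℝ := pd u n 0 0 0 with ha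
  set b : ℝ := pd u (n - 1) 1 0 0 with hb
  have hfac : (n.factorial : ℝ) ≠ 0 := by positivity
  set c : ℂ := ⟨a / n.factorial, -(b / n.factorial)⟩ with hc
  have hH : ∀ x y, Har c n x y = a / n.factorial * ReZ n x y + b / n.factorial * ImZ n x y := by
    intro x y
    simp [Har, ReZ, ImZ, hc, Complex.mul_re]
  let cf : ℕ → ℝ := fun m => (pd u 0 m 0 0 - pd (Har c n) 0 m 0 0) / m.factorial
  let P : Polynomial ℝ := ∑ m ∈ Finset.range (n + 1), Polynomial.monomial m (cf m)
  have hPc : ∀ m, m < n + 1 → P.coeff m = cf m := by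
    intro m hm
    simp only [P, Polynomial.finsetSum_coeff, Polynomial.coeff_monomial]
    rw [Finset.sum_ite_eq']
    simp [hm]
  have top : ∀ i j, i + 1 + j = n → pd u (i + 1) j 0 0 = pd (Har c n) (i + 1) j 0 0 := by
    intro i j hij
    rw [Har_pd_eq c hij]
    rcases Nat.even_or_odd' j with ⟨r, rfl | rfl⟩
    · have := ev r (by omega)
      rw [show n - 2 * r = i + 1 by omega] at this
      rw [this, pow_mul, Complex.I_sq]
      have h5 : ((-1 : ℂ) ^ r) = (((-1 : ℝ) ^ r : ℝ) : ℂ) := by push_cast; rfl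
      rw [h5, Complex.re_ofReal_mul]
      simp only [hc]
      field_simp
    · have := od r (by omega)
      rw [show n - (2 * r + 1) = i + 1 by omega] at this
      rw [this, pow_succ, pow_mul, Complex.I_sq]
      have h5 : ((-1 : ℂ) ^ r) = (((-1 : ℝ) ^ r : ℝ) : ℂ) := by push_cast; rfl
      rw [h5, mul_assoc, Complex.re_ofReal_mul, Complex.I_mul_re]
      simp only [hc]
      field_simp
  -- remainder
  let Q : ℝ → ℝ → ℝ := fun x y => Pol (-P) x y + Har (-c) n x y
  have sQ : Sm Q := (Pol_sm _).add (Har_sm _ _)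
  have sW := su.add sQ
  have vW : Van (n + 1) (fun x y => u x y + Q x y) := by
    apply Van.of_pd sW
    intro i j hij
    have hQ : pd Q i j 0 0 = pd (Pol (-P)) i j 0 0 + pd (Har (-c) n) i j 0 0 :=
      (Pol_sm _).pd_add (Har_sm _ _) i j 0 0 zero_mem_B1
    rw [su.pd_add sQ i j 0 0 zero_mem_B1]
    beta_reduce
    rw [hQ]
    have hneg : pd (Har (-c) n) i j 0 0 = - pd (Har c n) i j 0 0 := by
      simp [Har_pd, Har]
    rw [hneg]
    rcases i with _ | i
    · rw [Pol_pd_zero, Polynomial.coeff_neg, hPc j (by omega)]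
      have : (j.factorial : ℝ) ≠ 0 := by positivity
      simp only [cf]
      field_simp
      ring
    · rw [Pol_pd_succ]
      rcases Nat.lt_or_ge (i + 1 + j) n with h | h
      · rw [low i j (by omega), Har_pd_lt c h]; simp
      · rw [top i j (by omega)]; simp
  obtain ⟨C, hC, δ, hδ, hb2⟩ := Van.bound sW vW
  obtain ⟨r, hr⟩ : ∃ r, n = r + 3 := ⟨n - 3, by omega⟩
  refine ⟨C, hC, fun p => ∑ m ∈ Finset.range (r + 1), cf (m + 3) * p.2 ^ (m + 1), ?_, δ, hδ, ?_⟩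
  · have hcont : Continuous
      (fun p : ℝ × ℝ => ∑ m ∈ Finset.range (r + 1), cf (m + 3) * p.2 ^ (m + 1)) := by fun_prop
    have := hcont.tendsto 0
    simpa using this
  · intro x y hxy
    have hs : 0 ≤ x ^ 2 + y ^ 2 := by positivity
    have hnorm : ‖(x, y)‖ ≤ Real.sqrt (x ^ 2 + y ^ 2) := by
      rw [Prod.norm_def]
      apply max_le
      · exact Real.abs_le_sqrt (by nlinarith [sq_nonneg y])
      · exact Real.abs_le_sqrt (by nlinarith [sq_nonneg x])
    have hlt : ‖(x, y)‖ < δ := lt_of_le_of_lt hnorm (by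
      rw [Real.sqrt_lt' hδ]; exact hxy)
    have h6 := hb2 (x, y) hlt
    have hpw : (x ^ 2 + y ^ 2) ^ (((n : ℝ) + 1) / 2) = Real.sqrt (x ^ 2 + y ^ 2) ^ (n + 1) := by
      rw [Real.sqrt_eq_rpow, ← Real.rpow_natCast _ (n + 1), ← Real.rpow_mul hs]
      congr 1; push_cast; ring
    have hPe : P.eval y = u 0 0 + (pd u 0 2 0 0 / 2
        + ∑ m ∈ Finset.range (r + 1), cf (m + 3) * y ^ (m + 1)) * y ^ 2 := by
      have c0 : cf 0 = u 0 0 := by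
        simp only [cf]; rw [Har_pd_lt c (by omega)]; simp [pd]
      have c1 : cf 1 = 0 := by
        simp only [cf]; rw [Har_pd_lt c (by omega), hcy]; simp
      have c2 : cf 2 = pd u 0 2 0 0 / 2 := by
        simp only [cf]; rw [Har_pd_lt c (by omega)]; simp
      simp only [P, Polynomial.eval_finsetSum, Polynomial.eval_monomial]
      rw [hr, show r + 3 + 1 = r + 1 + 1 + 1 + 1 by ring, Finset.sum_range_succ',
        Finset.sum_range_succ', Finset.sum_range_succ']
      simp only [zero_add, c0, c1, Nat.reduceAdd, c2]
      rw [add_mul, Finset.sum_mul]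
      have : ∀ m ∈ Finset.range (r + 1), cf (m + 1 + 1 + 1) * y ^ (m + 1 + 1 + 1)
          = cf (m + 3) * y ^ (m + 1) * y ^ 2 := by
        intro m _
        rw [show m + 1 + 1 + 1 = m + 3 by ring]; ring
      rw [Finset.sum_congr rfl this]
      ring
    have hneg : Har (-c) n x y = - Har c n x y := by simp [Har]
    rw [hpw]
    refine le_trans (le_of_eq ?_) (h6.trans ?_)
    · simp only [Q, Pol, Polynomial.eval_neg, hneg, hH, hPe]
      congr 1; ring
    · gcongr
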